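/- If u is a nonnegative Lipschitz function on a bounded Lipschitz domain Ω ⊆ ℝⁿ (n ≥ 2) with Lipschitz constant L, and there is γ > 0 such that the perimeter of {u > t} relative to Ω satisfies P_Ω{u > t} ≥ γ·μ(t)^(1−1/n) for all t ≥ 0, then the distribution function μ is strictly decreasing on (0, sup u) and satisfies μ(t−h) − μ(t) ≥ (γ/L)·h·μ(t)^(1−1/n) for all 0 < h < t. -/

import Mathlib

open MeasureTheory Set Metric Filter

/-- The distribution function `μ(t) = |{x ∈ Ω : u(x) > t}|`. -/
noncomputable def distrib {n : ℕ} (Ω : Set (EuclideanSpace ℝ (Fin n)))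
    (u : EuclideanSpace ℝ (Fin n) → ℝ) (t : ℝ) : ℝ :=
  (volume {x ∈ Ω | t < u x}).toReal

/-- The decreasing rearrangement `u*(s) = inf {t : μ(t) ≤ s}`. -/
noncomputable def rearr {n : ℕ} (Ω : Set (EuclideanSpace ℝ (Fin n)))
    (u : EuclideanSpace ℝ (Fin n) → ℝ) (s : ℝ) : ℝ :=
  sInf {t : ℝ | distrib Ω u t ≤ s}


/-- The De Giorgi perimeter of a set `E` relative to an open set `Ω`, defined by
duality with compactly supported `C¹` vector fields of norm at most one. -/
noncomputable def relPerimeter {n : ℕ} (Ω E : Set (EuclideanSpace ℝ (Fin n))) : ℝ :=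
  sSup { r : ℝ | ∃ φ : EuclideanSpace ℝ (Fin n) → EuclideanSpace ℝ (Fin n),
    ContDiff ℝ 1 φ ∧ HasCompactSupport φ ∧ tsupport φ ⊆ Ω ∧ (∀ x, ‖φ x‖ ≤ 1) ∧
    r = ∫ x in E, ∑ i, fderiv ℝ φ x (EuclideanSpace.single i 1) i }

open Topology

/-- An antitone function whose lower right decay rate is at least `c` at every point of `[a, b)`
drops by at least `c * (b - a)` on `[a, b]`. -/
lemma Antitone.mul_sub_le_of_frequently {m : ℝ → ℝ} (hm : Antitone m) {a b c : ℝ} (hab : a < b)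
    (h : ∀ s ∈ Ico a b, ∀ c' < c, ∃ᶠ k in 𝓝[>] (0 : ℝ), c' * k ≤ m s - m (s + k)) :
    c * (b - a) ≤ m a - m b := by
  rw [← le_div_iff₀ (sub_pos.2 hab)]
  refine le_of_forall_lt_imp_le_of_dense fun c' hc' => ?_
  rw [le_div_iff₀ (sub_pos.2 hab)]
  let A := {s ∈ Icc a b | c' * (s - a) ≤ m a - m s}
  have hAne : A.Nonempty := ⟨a, ⟨le_rfl, hab.le⟩, by simp⟩
  have hAbd : BddAbove A := ⟨b, fun s hs => hs.1.2⟩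
  have hmem : sSup A ∈ A := by
    have hcl : IsClosed {s ∈ Icc a b | c' * (s - a) ≤ m a - m (sSup A)} :=
      isClosed_Icc.inter (s₂ := {s | c' * (s - a) ≤ m a - m (sSup A)})
        (isClosed_le (by fun_prop) continuous_const)
    have hsub : A ⊆ {s ∈ Icc a b | c' * (s - a) ≤ m a - m (sSup A)} := fun s hs =>
      ⟨hs.1, by linarith [hs.2, hm (le_csSup hAbd hs)]⟩
    exact closure_minimal hsub hcl (csSup_mem_closure hAne hAbd)
  rcases hmem.1.2.eq_or_lt with heq | hlt
  · have := hmem.2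
    rwa [heq] at this
  · obtain ⟨k, hk, hk0⟩ := ((h _ ⟨hmem.1.1, hlt⟩ c' hc').and_eventually
      (Ioo_mem_nhdsGT (sub_pos.2 hlt))).exists
    have : sSup A + k ∈ A :=
      ⟨⟨by linarith [hmem.1.1, hk0.1], by linarith [hk0.2]⟩, by linarith [hmem.2]⟩
    linarith [le_csSup hAbd this, hk0.1]

section Perimeter

variable {n : ℕ}

local notation "E" => EuclideanSpace ℝ (Fin n)

/-- The divergence of a vector field on Euclidean space. -/
noncomputable def euclideanDiv (φ : EuclideanSpace ℝ (Fin n) → EuclideanSpace ℝ (Fin n))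
    (x : EuclideanSpace ℝ (Fin n)) : ℝ :=
  ∑ i, fderiv ℝ φ x (EuclideanSpace.single i 1) i

lemma continuous_euclideanDiv {φ : E → E} (hφ : ContDiff ℝ 1 φ) :
    Continuous (euclideanDiv φ) := by
  have := hφ.continuous_fderiv one_ne_zero
  unfold euclideanDiv
  fun_prop

lemma euclideanDiv_eq_zero_of_notMem_tsupport {φ : E → E} {x : E} (hx : x ∉ tsupport φ) :
    euclideanDiv φ x = 0 := by
  have : fderiv ℝ φ x = 0 := by
    by_contra h
    exact hx (support_fderiv_subset ℝ h)
  simp [euclideanDiv, this]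

lemma integrable_euclideanDiv {φ : E → E} (hφ : ContDiff ℝ 1 φ) (hc : HasCompactSupport φ) :
    Integrable (euclideanDiv φ) :=
  (continuous_euclideanDiv hφ).integrable_of_hasCompactSupport
    (HasCompactSupport.intro hc fun _ hx => euclideanDiv_eq_zero_of_notMem_tsupport hx)

/-- Integration by parts of a Lipschitz function against a compactly supported `C¹` field. -/
lemma LipschitzWith.integral_mul_euclideanDiv {K : NNReal} {f : E → ℝ} (hf : LipschitzWith K f)
    {φ : E → E} (hφ : ContDiff ℝ 1 φ) (hc : HasCompactSupport φ) :
    ∫ x, f x * euclideanDiv φ x = -∫ x, fderiv ℝ f x (φ x) := by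
  have hcomp (i : Fin n) : ContDiff ℝ 1 fun x => φ x i :=
    (EuclideanSpace.proj (𝕜 := ℝ) i).contDiff.comp hφ
  have hcs (i : Fin n) : HasCompactSupport fun x => φ x i :=
    hc.comp_left (g := fun y : E => y i) rfl
  have hder (x : E) (v : E) (i : Fin n) :
      lineDeriv ℝ (fun x => φ x i) x v = fderiv ℝ φ x v i := by
    rw [((hcomp i).differentiable one_ne_zero x).lineDeriv_eq_fderiv]
    have := ((EuclideanSpace.proj (𝕜 := ℝ) i).hasFDerivAt.comp x
      (hφ.differentiable one_ne_zero x).hasFDerivAt).fderiv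
    exact congrArg (fun T : E →L[ℝ] ℝ => T v) this
  have hdc := hφ.continuous_fderiv one_ne_zero
  have hfc := hf.continuous
  have hparts (i : Fin n) :
      ∫ x, f x * fderiv ℝ φ x (EuclideanSpace.single i 1) i =
        -∫ x, lineDeriv ℝ f x (EuclideanSpace.single i 1) * φ x i := by
    obtain ⟨D, hD⟩ := (hcomp i).lipschitzWith_of_hasCompactSupport (hcs i) one_ne_zero
    rw [hf.integral_lineDeriv_mul_eq hD (hcs i), ← integral_neg]
    refine integral_congr_ae (.of_forall fun x => ?_)
    simp only [hder, map_neg, PiLp.neg_apply]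
    ring
  have hint₁ (i : Fin n) :
      Integrable fun x => f x * fderiv ℝ φ x (EuclideanSpace.single i 1) i := by
    refine Continuous.integrable_of_hasCompactSupport (by fun_prop)
      (HasCompactSupport.intro (hc.fderiv ℝ) fun x hx => ?_)
    simp [image_eq_zero_of_notMem_tsupport hx]
  have hint₂ (i : Fin n) :
      Integrable fun x => lineDeriv ℝ f x (EuclideanSpace.single i 1) * φ x i :=
    ((hcomp i).continuous.integrable_of_hasCompactSupport (hcs i)).mul_of_top_right
      (hf.memLp_lineDeriv _)
  calc ∫ x, f x * euclideanDiv φ x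
      = ∑ i, ∫ x, f x * fderiv ℝ φ x (EuclideanSpace.single i 1) i := by
        simp only [euclideanDiv, Finset.mul_sum]
        exact integral_finsetSum _ fun i _ => hint₁ i
    _ = -∫ x, ∑ i, lineDeriv ℝ f x (EuclideanSpace.single i 1) * φ x i := by
        rw [integral_finsetSum _ fun i _ => hint₂ i, ← Finset.sum_neg_distrib]
        exact Finset.sum_congr rfl fun i _ => hparts i
    _ = -∫ x, fderiv ℝ f x (φ x) := by
        congr 1
        refine integral_congr_ae ?_
        filter_upwards [hf.ae_differentiableAt] with x hx
        have hsum := (EuclideanSpace.basisFun (Fin n) ℝ).sum_repr (φ x)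
        simp only [EuclideanSpace.basisFun_repr, EuclideanSpace.basisFun_apply] at hsum
        conv_rhs => rw [← hsum]
        simp [hx.lineDeriv_eq_fderiv, mul_comm]

/-- The continuous ramp vanishing for `y ≤ s` and equal to one for `s + k ≤ y`. -/
noncomputable def ramp (s k y : ℝ) : ℝ := max 0 (min 1 (k⁻¹ * (y - s)))

lemma ramp_nonneg (s k y : ℝ) : 0 ≤ ramp s k y := le_max_left _ _

lemma ramp_le_one (s k y : ℝ) : ramp s k y ≤ 1 := max_le zero_le_one (min_le_left _ _)

lemma ramp_eq_zero {s k y : ℝ} (hk : 0 < k) (hy : y ≤ s) : ramp s k y = 0 :=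
  max_eq_left ((min_le_right _ _).trans
    (mul_nonpos_of_nonneg_of_nonpos (inv_nonneg.2 hk.le) (sub_nonpos.2 hy)))

lemma ramp_eq_one {s k y : ℝ} (hk : 0 < k) (hy : s + k ≤ y) : ramp s k y = 1 := by
  have : 1 ≤ k⁻¹ * (y - s) := by
    rw [← inv_mul_cancel₀ hk.ne']
    gcongr
    linarith
  simp [ramp, min_eq_left this]

lemma LipschitzWith.ramp {L : NNReal} {v : E → ℝ} (hv : LipschitzWith L v) (s : ℝ) {k : ℝ}
    (hk : 0 < k) : LipschitzWith (k⁻¹.toNNReal * L) fun x => ramp s k (v x) := by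
  refine LipschitzWith.const_max (LipschitzWith.const_min ?_ _) _
  refine LipschitzWith.of_dist_le_mul fun x y => ?_
  have := hv.dist_le_mul x y
  rw [Real.dist_eq] at this ⊢
  rw [← mul_sub, sub_sub_sub_cancel_right, abs_mul, abs_of_pos (inv_pos.2 hk), NNReal.coe_mul,
    Real.coe_toNNReal _ (inv_pos.2 hk).le, mul_assoc]
  gcongr

/-- The flux of an admissible field through the level sets of a Lipschitz function `v` between
the levels `s` and `s + k` is controlled by the measure of the region in between. -/
lemma integral_ramp_mul_euclideanDiv_le {Ω : Set E} (hΩo : IsOpen Ω) (hΩ : volume Ω ≠ ⊤)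
    {L : NNReal} {v : E → ℝ} (hv : LipschitzWith L v) {φ : E → E} (hφ : ContDiff ℝ 1 φ)
    (hc : HasCompactSupport φ) (hsub : tsupport φ ⊆ Ω) (hle : ∀ x, ‖φ x‖ ≤ 1)
    (s : ℝ) {k : ℝ} (hk : 0 < k) :
    ∫ x, ramp s k (v x) * euclideanDiv φ x ≤ k⁻¹ * L * (distrib Ω v s - distrib Ω v (s + k)) := by
  let S := {x ∈ Ω | s < v x} \ {x ∈ Ω | s + k < v x}
  have hmeas (t : ℝ) : MeasurableSet {x ∈ Ω | t < v x} :=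
    (hΩo.inter (isOpen_lt continuous_const hv.continuous)).measurableSet
  have hfin (t : ℝ) : volume {x ∈ Ω | t < v x} ≠ ⊤ :=
    ne_top_of_le_ne_top hΩ (measure_mono (sep_subset _ _))
  have hvol : volume.real S = distrib Ω v s - distrib Ω v (s + k) :=
    measureReal_sdiff (fun x hx => ⟨hx.1, by linarith [hx.2]⟩) (hmeas _) (hfin _)
  have hlip := hv.ramp s hk
  have hzero (x : E) (hx : x ∉ S) : fderiv ℝ (fun x => ramp s k (v x)) x (φ x) = 0 := by
    by_cases hxΩ : x ∈ Ω
    · rcases le_or_gt (v x) s with h | h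
      · have : IsLocalMin (fun x => ramp s k (v x)) x := .of_forall fun y => by
          simpa only [ramp_eq_zero hk h] using ramp_nonneg s k (v y)
        simp [this.fderiv_eq_zero]
      · have h' : s + k ≤ v x := by
          by_contra! hlt
          exact hx ⟨⟨hxΩ, h⟩, fun h'' => absurd h''.2 hlt.not_gt⟩
        have : IsLocalMax (fun x => ramp s k (v x)) x := .of_forall fun y => by
          simpa only [ramp_eq_one hk h'] using ramp_le_one s k (v y)
        simp [this.fderiv_eq_zero]
    · simp [image_eq_zero_of_notMem_tsupport fun h => hxΩ (hsub h)]
  rw [hlip.integral_mul_euclideanDiv hφ hc, ← setIntegral_eq_integral_of_forall_compl_eq_zero hzero,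
    ← hvol]
  refine (neg_le_abs _).trans ?_
  rw [← Real.norm_eq_abs]
  refine norm_setIntegral_le_of_norm_le_const
    ((measure_mono sdiff_subset).trans_lt (hfin s).lt_top) fun x _ => ?_
  calc ‖fderiv ℝ (fun x => ramp s k (v x)) x (φ x)‖
      ≤ ‖fderiv ℝ (fun x => ramp s k (v x)) x‖ * ‖φ x‖ := ContinuousLinearMap.le_opNorm _ _
    _ ≤ (k⁻¹.toNNReal * L : NNReal) * 1 := by
        gcongr
        exacts [norm_fderiv_le_of_lipschitz ℝ hlip, hle x]
    _ = k⁻¹ * L := by simp [hk.le]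

lemma tendsto_integral_ramp_mul_euclideanDiv {v : E → ℝ} (hv : Continuous v)
    {φ : E → E} (hφ : ContDiff ℝ 1 φ) (hc : HasCompactSupport φ) (s : ℝ) :
    Tendsto (fun k => ∫ x, ramp s k (v x) * euclideanDiv φ x) (𝓝[>] 0)
      (𝓝 (∫ x in {x | s < v x}, euclideanDiv φ x)) := by
  have hdc := continuous_euclideanDiv hφ
  rw [← integral_indicator (isOpen_lt continuous_const hv).measurableSet]
  refine tendsto_integral_filter_of_dominated_convergence (fun x => ‖euclideanDiv φ x‖)
    (.of_forall fun k => ?_) (.of_forall fun k => .of_forall fun x => ?_)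
    (integrable_euclideanDiv hφ hc).norm (.of_forall fun x => ?_)
  · refine Continuous.aestronglyMeasurable ?_
    unfold ramp
    fun_prop
  · rw [norm_mul, Real.norm_of_nonneg (ramp_nonneg _ _ _)]
    exact mul_le_of_le_one_left (norm_nonneg _) (ramp_le_one _ _ _)
  · refine tendsto_const_nhds.congr' ?_
    rcases le_or_gt (v x) s with h | h
    · filter_upwards [self_mem_nhdsWithin] with k hk
      simp [ramp_eq_zero hk h, h]
    · filter_upwards [Ioo_mem_nhdsGT (sub_pos.2 h)] with k hk
      simp [ramp_eq_one hk.1 (show s + k ≤ v x by linarith [hk.2]), h]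

/-- The relative perimeter of a superlevel set of an `L`-Lipschitz function is at most `L` times
the lower right decay rate of its distribution function. -/
lemma eventually_mul_le_distrib_sub_of_lt_relPerimeter {Ω : Set E} (hΩo : IsOpen Ω)
    (hΩ : volume Ω ≠ ⊤) {L : NNReal} {v : E → ℝ} (hv : LipschitzWith L v) {s c : ℝ}
    (hlt : c < relPerimeter Ω {x ∈ Ω | s < v x}) :
    ∀ᶠ k in 𝓝[>] (0 : ℝ), c * k ≤ L * (distrib Ω v s - distrib Ω v (s + k)) := by
  obtain ⟨r, ⟨φ, hφ, hc, hsub, hle, rfl⟩, hr⟩ := exists_lt_of_lt_csSup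
    (by exact ⟨0, 0, contDiff_const, .zero, by simp [tsupport], by simp, by simp⟩) hlt
  change c < ∫ x in {x ∈ Ω | s < v x}, euclideanDiv φ x at hr
  have heq : ∫ x in {x ∈ Ω | s < v x}, euclideanDiv φ x =
      ∫ x in {x | s < v x}, euclideanDiv φ x := by
    refine (setIntegral_eq_of_subset_of_forall_sdiff_eq_zero
      (isOpen_lt continuous_const hv.continuous).measurableSet (fun x hx => hx.2) fun x hx => ?_).symm
    exact euclideanDiv_eq_zero_of_notMem_tsupport fun h => hx.2 ⟨hsub h, hx.1⟩
  rw [heq] at hr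
  filter_upwards [(tendsto_integral_ramp_mul_euclideanDiv hv.continuous hφ hc s).eventually_const_lt
    hr, self_mem_nhdsWithin] with k hk hk0
  have hk0 : 0 < k := hk0
  have := hk.le.trans (integral_ramp_mul_euclideanDiv_le hΩo hΩ hv hφ hc hsub hle s hk0)
  rwa [mul_assoc, inv_mul_eq_div, le_div_iff₀ hk0] at this

lemma antitone_distrib {Ω : Set E} (hΩ : volume Ω ≠ ⊤) (u : E → ℝ) : Antitone (distrib Ω u) :=
  fun _ _ hst => ENNReal.toReal_mono (ne_top_of_le_ne_top hΩ (measure_mono (sep_subset _ _)))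
    (measure_mono fun _ hx => ⟨hx.1, hst.trans_lt hx.2⟩)

lemma distrib_pos {Ω : Set E} (hΩo : IsOpen Ω) (hΩ : volume Ω ≠ ⊤) {u : E → ℝ}
    (hu : ContinuousOn u Ω) {t : ℝ} (ht : ∃ x ∈ Ω, t < u x) : 0 < distrib Ω u t := by
  refine ENNReal.toReal_pos (IsOpen.measure_pos volume ?_ ht).ne'
    (ne_top_of_le_ne_top hΩ (measure_mono (sep_subset _ _)))
  exact hu.isOpen_inter_preimage hΩo isOpen_Ioi

end Perimeter

theorem distrib_strictAnti_of_isoperimetric {n : ℕ} (hn : 2 ≤ n)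
    (Ω : Set (EuclideanSpace ℝ (Fin n))) (u : EuclideanSpace ℝ (Fin n) → ℝ)
    (hΩo : IsOpen Ω) (hΩbd : Bornology.IsBounded Ω)
    (L : NNReal) (hL : 0 < (L : ℝ)) (hu : LipschitzOnWith L u Ω)
    (hu0 : ∀ x ∈ Ω, 0 ≤ u x)
    (γ : ℝ) (hγ : 0 < γ)
    (hiso : ∀ t : ℝ, 0 ≤ t →
      γ * (distrib Ω u t) ^ ((1 : ℝ) - 1 / n) ≤ relPerimeter Ω {x ∈ Ω | t < u x}) :
    StrictAntiOn (distrib Ω u) (Set.Ioo 0 (sSup (u '' Ω))) ∧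
    ∀ t h : ℝ, 0 < h → h < t →
      (γ / L) * h * (distrib Ω u t) ^ ((1 : ℝ) - 1 / n)
        ≤ distrib Ω u (t - h) - distrib Ω u t := by
  have hΩ : volume Ω ≠ ⊤ := hΩbd.measure_lt_top.ne
  have hdrop : ∀ t h : ℝ, 0 < h → h < t →
      (γ / L) * h * (distrib Ω u t) ^ ((1 : ℝ) - 1 / n)
        ≤ distrib Ω u (t - h) - distrib Ω u t := by
    intro t h h0 hht
    obtain ⟨v, hv, huv⟩ := hu.extend_real
    have hset (s : ℝ) : {x ∈ Ω | s < u x} = {x ∈ Ω | s < v x} := by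
      ext x
      exact and_congr_right fun hx => by rw [huv hx]
    have hdist : distrib Ω u = distrib Ω v := by
      funext s
      simp only [distrib, hset]
    have hp : (0 : ℝ) ≤ 1 - 1 / n := by
      have : (1 : ℝ) ≤ n := by exact_mod_cast one_le_two.trans hn
      rw [sub_nonneg, div_le_one (by linarith)]
      exact this
    have key := (antitone_distrib hΩ v).mul_sub_le_of_frequently (sub_lt_self t h0)
      (c := (γ / L) * (distrib Ω u t) ^ ((1 : ℝ) - 1 / n)) fun s hs c' hc' => by
        have hlt : L * c' < relPerimeter Ω {x ∈ Ω | s < v x} := by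
          rw [← hset]
          refine lt_of_lt_of_le ?_ (hiso s (by linarith [hs.1]))
          calc L * c' < L * ((γ / L) * (distrib Ω u t) ^ ((1 : ℝ) - 1 / n)) := by gcongr
            _ = γ * (distrib Ω u t) ^ ((1 : ℝ) - 1 / n) := by field_simp
            _ ≤ γ * (distrib Ω u s) ^ ((1 : ℝ) - 1 / n) := by
                have := antitone_distrib hΩ u hs.2.le
                have : 0 ≤ distrib Ω u t := ENNReal.toReal_nonneg
                gcongr
        refine Eventually.frequently ?_
        filter_upwards [eventually_mul_le_distrib_sub_of_lt_relPerimeter hΩo hΩ hv hlt] with k hk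
        rw [mul_assoc] at hk
        exact le_of_mul_le_mul_left hk hL
    rw [hdist] at key ⊢
    calc _ = _ := by ring
      _ ≤ _ := key
  refine ⟨fun s hs t ht hst => ?_, hdrop⟩
  have hne : (u '' Ω).Nonempty := by
    by_contra h
    rw [not_nonempty_iff_eq_empty] at h
    simp [h] at ht
  obtain ⟨_, ⟨x, hx, rfl⟩, hxt⟩ := exists_lt_of_lt_csSup hne ht.2
  have hpos := distrib_pos hΩo hΩ hu.continuousOn ⟨x, hx, hxt⟩
  have hd := hdrop t (t - s) (sub_pos.2 hst) (sub_lt_self t hs.1)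
  rw [sub_sub_cancel] at hd
  have : 0 < (γ / L) * (t - s) * (distrib Ω u t) ^ ((1 : ℝ) - 1 / n) :=
    mul_pos (mul_pos (div_pos hγ hL) (sub_pos.2 hst)) (Real.rpow_pos_of_pos hpos _)
  linarith
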